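/- Let η_1, η_2, θ_1, θ_2, ξ_1, ξ_2 be almost surely positive random variables with η_1·θ_1 = ξ_1 in distribution and η_2·θ_2 = ξ_2 in distribution, where η_i is independent of θ_i for i = 1, 2. Assume θ_1 and θ_2 have the same distribution, ξ_1 and ξ_2 have the same distribution. Then η_1 and η_2 have the same distribution. -/

import Mathlib

open MeasureTheory ProbabilityTheory

/-- Additive convolution with a law whose characteristic function vanishes nowhere is
cancellable. -/
theorem map_eq_of_map_add_eq_of_charFun_ne_zero
    {Ω : Type*} [MeasurableSpace Ω] {P : Measure Ω} [IsProbabilityMeasure P]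
    {X₁ X₂ Y₁ Y₂ : Ω → ℝ} (hX₁ : Measurable X₁) (hX₂ : Measurable X₂)
    (hY₁ : Measurable Y₁) (hY₂ : Measurable Y₂)
    (h₁ : IndepFun X₁ Y₁ P) (h₂ : IndepFun X₂ Y₂ P)
    (hY : P.map Y₁ = P.map Y₂) (hsum : P.map (X₁ + Y₁) = P.map (X₂ + Y₂))
    (hchar : ∀ t, charFun (P.map Y₁) t ≠ 0) :
    P.map X₁ = P.map X₂ := by
  have := Measure.isProbabilityMeasure_map hX₁.aemeasurable (μ := P)
  have := Measure.isProbabilityMeasure_map hX₂.aemeasurable (μ := P)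
  refine Measure.ext_of_charFun (funext fun t => mul_right_cancel₀ (hchar t) ?_)
  have e := congrArg (fun μ => charFun μ t) hsum
  simp only [h₁.charFun_map_add_eq_mul hX₁.aemeasurable hY₁.aemeasurable,
    h₂.charFun_map_add_eq_mul hX₂.aemeasurable hY₂.aemeasurable, Pi.mul_apply, ← hY] at e
  exact e

/-- The law of an almost surely positive variable is determined by the law of its logarithm. -/
theorem map_exp_map_log {Ω : Type*} [MeasurableSpace Ω] {P : Measure Ω} {X : Ω → ℝ}
    (hX : Measurable X) (hpos : ∀ᵐ ω ∂P, 0 < X ω) :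
    (P.map (fun ω => Real.log (X ω))).map Real.exp = P.map X := by
  rw [Measure.map_map Real.measurable_exp hX.log]
  refine Measure.map_congr ?_
  filter_upwards [hpos] with ω h using Real.exp_log h

/-- For almost surely positive variables, the sum of the logarithms has the law of the logarithm
of the product. -/
theorem map_log_add_log {Ω : Type*} [MeasurableSpace Ω] {P : Measure Ω} {X Y : Ω → ℝ}
    (hX : Measurable X) (hY : Measurable Y)
    (hXpos : ∀ᵐ ω ∂P, 0 < X ω) (hYpos : ∀ᵐ ω ∂P, 0 < Y ω) :
    P.map ((fun ω => Real.log (X ω)) + fun ω => Real.log (Y ω)) =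
      (P.map (fun ω => X ω * Y ω)).map Real.log := by
  rw [Measure.map_map Real.measurable_log (by fun_prop)]
  refine Measure.map_congr ?_
  filter_upwards [hXpos, hYpos] with ω hx hy using (Real.log_mul hx.ne' hy.ne').symm

/-- if `ηᵢ·θᵢ = ξᵢ` with `ηᵢ` independent of `θᵢ`, `θ₁ ≐ θ₂`,
`ξ₁ ≐ ξ₂`, all variables a.s. positive, and (as permitted by the context) the
characteristic function of `log θ₁` vanishes nowhere, then `η₁ ≐ η₂`. -/
theorem eq_in_distribution_of_independent_factors
    {Ω : Type*} [MeasurableSpace Ω] (P : Measure Ω) [IsProbabilityMeasure P]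
    (η₁ η₂ θ₁ θ₂ ξ₁ ξ₂ : Ω → ℝ)
    (hη₁ : Measurable η₁) (hη₂ : Measurable η₂)
    (hθ₁ : Measurable θ₁) (hθ₂ : Measurable θ₂)
    (hposη₁ : ∀ᵐ ω ∂P, 0 < η₁ ω) (hposη₂ : ∀ᵐ ω ∂P, 0 < η₂ ω)
    (hposθ₁ : ∀ᵐ ω ∂P, 0 < θ₁ ω) (hposθ₂ : ∀ᵐ ω ∂P, 0 < θ₂ ω)
    (hposξ₁ : ∀ᵐ ω ∂P, 0 < ξ₁ ω) (hposξ₂ : ∀ᵐ ω ∂P, 0 < ξ₂ ω)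
    (hprod₁ : ∀ ω, η₁ ω * θ₁ ω = ξ₁ ω)
    (hprod₂ : ∀ ω, η₂ ω * θ₂ ω = ξ₂ ω)
    (hindep₁ : IndepFun η₁ θ₁ P) (hindep₂ : IndepFun η₂ θ₂ P)
    (hθ : Measure.map θ₁ P = Measure.map θ₂ P)
    (hξ : Measure.map ξ₁ P = Measure.map ξ₂ P)
    (hchar : ∀ t : ℝ,
      ∫ ω, Complex.exp ((t * Real.log (θ₁ ω)) * Complex.I) ∂P ≠ 0) :
    Measure.map η₁ P = Measure.map η₂ P := by
  have hlog := Real.measurable_log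
  have hlogθ : P.map (fun ω => Real.log (θ₁ ω)) = P.map (fun ω => Real.log (θ₂ ω)) := by
    have h := congrArg (Measure.map Real.log) hθ
    rwa [Measure.map_map hlog hθ₁, Measure.map_map hlog hθ₂] at h
  rw [← map_exp_map_log hη₁ hposη₁, ← map_exp_map_log hη₂ hposη₂]
  congr 1
  refine map_eq_of_map_add_eq_of_charFun_ne_zero (hlog.comp hη₁) (hlog.comp hη₂)
    (hlog.comp hθ₁) (hlog.comp hθ₂) (hindep₁.comp hlog hlog) (hindep₂.comp hlog hlog)
    hlogθ ?_ fun t => ?_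
  · refine (map_log_add_log hη₁ hθ₁ hposη₁ hposθ₁).trans
      (Eq.trans ?_ (map_log_add_log hη₂ hθ₂ hposη₂ hposθ₂).symm)
    rw [funext hprod₁, funext hprod₂, hξ]
  · rw [charFun_apply_real, integral_map (hlog.comp hθ₁).aemeasurable (by fun_prop)]
    exact hchar t
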